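/- Let (S, 𝒜, P) be a probability space, let ψ : [0,1] → [0,1] be nondecreasing with ψ(0) = 0 and ψ(1) = 1, and let v, u : S → ℝ be bounded measurable functions that are comonotonic. Then the distorted (Choquet) functional is additive on this pair: I_{ψ,P}(v + u) = I_{ψ,P}(v) + I_{ψ,P}(u). -/

import Mathlib

open MeasureTheory

/-- The distorted (Choquet) functional
`I_{ψ,P}(v) = ∫_{-∞}^0 (ψ(P(v > t)) − 1) dt + ∫_0^∞ ψ(P(v > t)) dt`. -/
noncomputable def distorted {S : Type*} [MeasurableSpace S] (P : Measure S)
    (ψ : ℝ → ℝ) (v : S → ℝ) : ℝ :=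
  (∫ t in Set.Iio (0 : ℝ), (ψ ((P {s | t < v s}).toReal) - 1)) +
    ∫ t in Set.Ioi (0 : ℝ), ψ ((P {s | t < v s}).toReal)

/-- The distorted survival function `t ↦ ψ(P(v > t))`. -/
noncomputable def distortedTail {S : Type*} [MeasurableSpace S] (P : Measure S)
    (ψ : ℝ → ℝ) (v : S → ℝ) (t : ℝ) : ℝ :=
  ψ ((P {s | t < v s}).toReal)

section Tail

variable {S : Type*} [MeasurableSpace S] (P : Measure S) {ψ : ℝ → ℝ}

lemma distortedTail_eq_zero (hψ0 : ψ 0 = 0) {v : S → ℝ} {M t : ℝ} (hv : ∀ s, |v s| ≤ M)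
    (ht : M ≤ t) : distortedTail P ψ v t = 0 := by
  have : {s | t < v s} = ∅ :=
    Set.eq_empty_of_forall_notMem fun s hs =>
      absurd (lt_of_le_of_lt ht hs) (not_lt.2 (abs_le.1 (hv s)).2)
  simp [distortedTail, this, hψ0]

variable [IsProbabilityMeasure P]

lemma toReal_measure_mem_Icc (A : Set S) : (P A).toReal ∈ Set.Icc (0 : ℝ) 1 :=
  ⟨ENNReal.toReal_nonneg, measureReal_le_one⟩

lemma distortion_measure_mono (hψ : MonotoneOn ψ (Set.Icc 0 1)) {A B : Set S} (h : A ⊆ B) :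
    ψ (P A).toReal ≤ ψ (P B).toReal :=
  hψ (toReal_measure_mem_Icc P A) (toReal_measure_mem_Icc P B) (measureReal_mono h)

lemma distortedTail_antitone (hψ : MonotoneOn ψ (Set.Icc 0 1)) (v : S → ℝ) :
    Antitone (distortedTail P ψ v) := fun _ _ hab =>
  distortion_measure_mono P hψ fun _ hs => lt_of_le_of_lt hab hs

lemma distortedTail_mem_Icc (hψ : Set.MapsTo ψ (Set.Icc 0 1) (Set.Icc 0 1)) (v : S → ℝ) (t : ℝ) :
    distortedTail P ψ v t ∈ Set.Icc (0 : ℝ) 1 :=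
  hψ (toReal_measure_mem_Icc P _)

lemma distortedTail_eq_one (hψ1 : ψ 1 = 1) {v : S → ℝ} {M t : ℝ} (hv : ∀ s, |v s| ≤ M)
    (ht : t < -M) : distortedTail P ψ v t = 1 := by
  have : {s | t < v s} = Set.univ :=
    Set.eq_univ_of_forall fun s => lt_of_lt_of_le ht (abs_le.1 (hv s)).1
  simp [distortedTail, this, hψ1]

lemma distorted_eq_integral_tail (hψ : MonotoneOn ψ (Set.Icc 0 1)) (hψ0 : ψ 0 = 0)
    (hψ1 : ψ 1 = 1) {v : S → ℝ} {M : ℝ} (hM : 0 ≤ M) (hv : ∀ s, |v s| ≤ M) :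
    distorted P ψ v = -M + ∫ t in -M..M, distortedTail P ψ v t := by
  have hint : ∀ a b, IntervalIntegrable (distortedTail P ψ v) volume a b := fun a b =>
    (distortedTail_antitone P hψ v).intervalIntegrable
  have hneg : ∫ t in Set.Iio (0 : ℝ), (distortedTail P ψ v t - 1)
      = ∫ t in -M..0, (distortedTail P ψ v t - 1) := by
    rw [intervalIntegral.integral_of_le (by linarith), integral_Ioc_eq_integral_Ioo,
      ← integral_Ico_eq_integral_Ioo]
    refine setIntegral_eq_of_subset_of_forall_sdiff_eq_zero measurableSet_Iio
      (fun t ht => ht.2) fun t ht => ?_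
    have : t < -M := by
      by_contra h
      exact ht.2 ⟨not_lt.1 h, ht.1⟩
    rw [distortedTail_eq_one P hψ1 hv this, sub_self]
  have hpos : ∫ t in Set.Ioi (0 : ℝ), distortedTail P ψ v t
      = ∫ t in (0 : ℝ)..M, distortedTail P ψ v t := by
    rw [intervalIntegral.integral_of_le hM]
    refine setIntegral_eq_of_subset_of_forall_sdiff_eq_zero measurableSet_Ioi
      (fun t ht => ht.1) fun t ht => ?_
    refine distortedTail_eq_zero P hψ0 hv (le_of_lt ?_)
    by_contra h
    exact ht.2 ⟨ht.1, not_lt.1 h⟩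
  have hsub : ∫ t in -M..0, (distortedTail P ψ v t - 1)
      = (∫ t in -M..0, distortedTail P ψ v t) - M := by
    rw [intervalIntegral.integral_sub (hint _ _) intervalIntegrable_const]
    simp
  change (∫ t in Set.Iio (0 : ℝ), (distortedTail P ψ v t - 1)) +
    ∫ t in Set.Ioi (0 : ℝ), distortedTail P ψ v t = _
  rw [hneg, hpos, hsub, ← intervalIntegral.integral_add_adjacent_intervals (hint (-M) 0) (hint 0 M)]
  ring

end Tail

/-- The generalized inverse at level `y` of a function `G` that is `1` below `-M` and `0` above `M`,
expressed through the length of the superlevel set. -/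
noncomputable def levelQuantile (G : ℝ → ℝ) (M y : ℝ) : ℝ :=
  -M + ∫ t in Set.Ioc (-M) M, {p : ℝ × ℝ | p.2 < G p.1}.indicator (fun _ => (1 : ℝ)) (t, y)

lemma integrable_indicator_subgraph {G : ℝ → ℝ} (hG : Measurable G) (M : ℝ) :
    Integrable ({p : ℝ × ℝ | p.2 < G p.1}.indicator fun _ => (1 : ℝ))
      ((volume.restrict (Set.Ioc (-M) M)).prod (volume.restrict (Set.Ioo (0 : ℝ) 1))) :=
  (integrable_const 1).indicator (measurableSet_lt measurable_snd (hG.comp measurable_fst))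

lemma integrable_levelQuantile {G : ℝ → ℝ} (hG : Measurable G) (M : ℝ) :
    Integrable (levelQuantile G M) (volume.restrict (Set.Ioo (0 : ℝ) 1)) :=
  (integrable_const (-M)).add (integrable_indicator_subgraph hG M).integral_prod_right

lemma integral_levelQuantile {G : ℝ → ℝ} (hG : Measurable G) (hG01 : ∀ t, G t ∈ Set.Icc (0 : ℝ) 1)
    {M : ℝ} (hM : 0 ≤ M) :
    ∫ y in Set.Ioo (0 : ℝ) 1, levelQuantile G M y = -M + ∫ t in -M..M, G t := by
  have hI := integrable_indicator_subgraph hG M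
  unfold levelQuantile
  rw [integral_add (integrable_const _) hI.integral_prod_right,
    ← integral_integral_swap
      (f := fun t y => {p : ℝ × ℝ | p.2 < G p.1}.indicator (fun _ => (1 : ℝ)) (t, y)) hI,
    intervalIntegral.integral_of_le (by linarith)]
  congr 1
  · simp
  · refine integral_congr_ae (Filter.Eventually.of_forall fun t => ?_)
    have hset : Set.Iio (G t) ∩ Set.Ioo (0 : ℝ) 1 = Set.Ioo 0 (G t) := by
      ext y
      have := (hG01 t).2
      simp only [Set.mem_inter_iff, Set.mem_Iio, Set.mem_Ioo]
      constructor
      · rintro ⟨h1, h2, -⟩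
        exact ⟨h2, h1⟩
      · rintro ⟨h1, h2⟩
        exact ⟨h2, h1, by linarith⟩
    have hfun : (fun y => {p : ℝ × ℝ | p.2 < G p.1}.indicator (fun _ => (1 : ℝ)) (t, y))
        = (Set.Iio (G t)).indicator fun _ => (1 : ℝ) := by
      ext y
      simp [Set.indicator_apply]
    change ∫ y in Set.Ioo (0 : ℝ) 1,
      {p : ℝ × ℝ | p.2 < G p.1}.indicator (fun _ => (1 : ℝ)) (t, y) = G t
    rw [hfun, integral_indicator measurableSet_Iio, Measure.restrict_restrict measurableSet_Iio,
      hset]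
    simp [(hG01 t).1]

lemma isLUB_levelQuantile {G : ℝ → ℝ} (hG : Antitone G) {M y : ℝ}
    (hG1 : ∀ t < -M, G t = 1) (hG0 : ∀ t, M ≤ t → G t = 0) (hy : y ∈ Set.Ioo (0 : ℝ) 1) :
    IsLUB {t | y < G t} (levelQuantile G M y) := by
  have hne : {t | y < G t}.Nonempty := ⟨-M - 1, by
    rw [Set.mem_ofPred_eq, hG1 _ (by linarith)]; exact hy.2⟩
  have hlt : ∀ t, y < G t → t < M := fun t ht => by
    by_contra h
    rw [hG0 t (not_lt.1 h)] at ht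
    exact absurd ht (not_lt.2 hy.1.le)
  have hbdd : BddAbove {t | y < G t} := ⟨M, fun t ht => (hlt t ht).le⟩
  have hlub := isLUB_csSup hne hbdd
  set q := sSup {t | y < G t} with hq
  have hqM : -M ≤ q := le_of_forall_lt fun t ht => by
    obtain ⟨r, hr, hr'⟩ := exists_between ht
    refine hr.trans_le (hlub.1 ?_)
    rw [Set.mem_ofPred_eq, hG1 _ hr']; exact hy.2
  have hmeas : MeasurableSet {t | y < G t} := measurableSet_lt measurable_const hG.measurable
  have hfun : (fun t => {p : ℝ × ℝ | p.2 < G p.1}.indicator (fun _ => (1 : ℝ)) (t, y))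
      = {t | y < G t}.indicator fun _ => (1 : ℝ) := by
    ext t
    simp [Set.indicator_apply]
  have hsub : {t | y < G t} ∩ Set.Ioc (-M) M ⊆ Set.Ioc (-M) q := fun t ht => ⟨ht.2.1, hlub.1 ht.1⟩
  have hsup : Set.Ioo (-M) q ⊆ {t | y < G t} ∩ Set.Ioc (-M) M := fun t ht => by
    obtain ⟨r, hr, hr'⟩ := exists_lt_of_lt_csSup hne ht.2
    have : y < G t := lt_of_lt_of_le hr (hG hr'.le)
    exact ⟨this, ht.1, (hlt t this).le⟩
  have hvol : volume ({t | y < G t} ∩ Set.Ioc (-M) M) = ENNReal.ofReal (q - -M) :=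
    le_antisymm ((measure_mono hsub).trans_eq Real.volume_Ioc)
      (Real.volume_Ioo.symm.trans_le (measure_mono hsup))
  have : levelQuantile G M y = q := by
    rw [levelQuantile, hfun, integral_indicator hmeas, Measure.restrict_restrict hmeas,
      setIntegral_const, measureReal_def, hvol, ENNReal.toReal_ofReal (by linarith)]
    simp
  rwa [this]

/-- Generalized inverses of survival functions are additive along comonotonic pairs: the superlevel
sets of `v` and `u` form a chain, so any two of them have their intersection and their union among
themselves. -/
lemma isLUB_add_of_comonotonic {S : Type*} {v u : S → ℝ}
    (hcomo : ∀ s s' : S, (v s' - v s) * (u s' - u s) ≥ 0) {U : Set S → Prop}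
    (hU : ∀ A B, A ⊆ B → U A → U B) {a b c : ℝ}
    (ha : IsLUB {t | U {s | t < v s}} a) (hb : IsLUB {t | U {s | t < u s}} b)
    (hc : IsLUB {t | U {s | t < v s + u s}} c) : c = a + b := by
  have chain : ∀ t r, {s | t < v s} ⊆ {s | r < u s} ∨ {s | r < u s} ⊆ {s | t < v s} := by
    intro t r
    by_contra! h
    obtain ⟨⟨x, hx, hx'⟩, y, hy, hy'⟩ := And.imp Set.not_subset.1 Set.not_subset.1 h
    simp only [Set.mem_ofPred_eq, not_lt] at hx hx' hy hy'
    nlinarith [hcomo x y, mul_pos (sub_pos.2 (hy'.trans_lt hx)) (sub_pos.2 (hx'.trans_lt hy))]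
  apply le_antisymm
  · refine hc.2 fun t ht => le_of_forall_pos_le_add fun ε hε => ?_
    by_contra! hlt
    have hv : ¬ U {s | a + ε / 2 < v s} := fun h => by linarith [ha.1 h]
    have hu : ¬ U {s | b + ε / 2 < u s} := fun h => by linarith [hb.1 h]
    have hcov : ∀ s, t < v s + u s → a + ε / 2 < v s ∨ b + ε / 2 < u s := fun s hs => by
      by_contra! h
      linarith [h.1, h.2]
    rcases chain (a + ε / 2) (b + ε / 2) with h | h
    · exact hu (hU _ _ (fun s hs => (hcov s hs).elim (fun k => h k) id) ht)
    · exact hv (hU _ _ (fun s hs => (hcov s hs).elim id (fun k => h k)) ht)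
  · refine le_of_forall_pos_le_add fun ε hε => ?_
    obtain ⟨t, ht, hat, -⟩ := ha.exists_between (show a - ε / 2 < a by linarith)
    obtain ⟨r, hr, hbr, -⟩ := hb.exists_between (show b - ε / 2 < b by linarith)
    have key : U {s | t + r < v s + u s} := by
      rcases chain t r with h | h
      · refine hU {s | t < v s} _ (fun s hs => ?_) ht
        have hs' : r < u s := h hs
        exact (add_lt_add hs hs' : t + r < v s + u s)
      · refine hU {s | r < u s} _ (fun s hs => ?_) hr
        have hs' : t < v s := h hs
        exact (add_lt_add hs' hs : t + r < v s + u s)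
    linarith [hc.1 key]

/-- The distorted (Choquet) functional is additive on comonotonic pairs of
bounded measurable random variables. -/
theorem distorted_add_of_comonotonic {S : Type*} [MeasurableSpace S] (P : Measure S)
    [IsProbabilityMeasure P]
    (ψ : ℝ → ℝ) (hψmono : MonotoneOn ψ (Set.Icc 0 1))
    (hψmap : Set.MapsTo ψ (Set.Icc 0 1) (Set.Icc 0 1))
    (hψ0 : ψ 0 = 0) (hψ1 : ψ 1 = 1)
    (v u : S → ℝ) (hv : Measurable v) (hu : Measurable u)
    (hvb : ∃ M, ∀ s, |v s| ≤ M) (hub : ∃ M, ∀ s, |u s| ≤ M)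
    (hcomo : ∀ s s' : S, (v s' - v s) * (u s' - u s) ≥ 0) :
    distorted P ψ (fun s => v s + u s) = distorted P ψ v + distorted P ψ u := by
  obtain ⟨Mv, hMv⟩ := hvb
  obtain ⟨Mu, hMu⟩ := hub
  obtain ⟨M, hM⟩ : ∃ M, M = |Mv| + |Mu| := ⟨_, rfl⟩
  have hM0 : 0 ≤ M := by rw [hM]; positivity
  have hvM : ∀ s, |v s| ≤ M := fun s => by
    linarith [hMv s, le_abs_self Mv, abs_nonneg Mu]
  have huM : ∀ s, |u s| ≤ M := fun s => by
    linarith [hMu s, le_abs_self Mu, abs_nonneg Mv]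
  have hvuM : ∀ s, |v s + u s| ≤ M := fun s => by
    linarith [hMv s, hMu s, le_abs_self Mu, le_abs_self Mv, abs_add_le (v s) (u s)]
  have hanti := distortedTail_antitone P hψmono
  have hrepr : ∀ w : S → ℝ, (∀ s, |w s| ≤ M) → distorted P ψ w
      = ∫ y in Set.Ioo (0 : ℝ) 1, levelQuantile (distortedTail P ψ w) M y := fun w hw => by
    rw [distorted_eq_integral_tail P hψmono hψ0 hψ1 hM0 hw,
      integral_levelQuantile (hanti w).measurable (distortedTail_mem_Icc P hψmap w) hM0]
  have hlub : ∀ w : S → ℝ, (∀ s, |w s| ≤ M) → ∀ y ∈ Set.Ioo (0 : ℝ) 1,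
      IsLUB {t | y < distortedTail P ψ w t} (levelQuantile (distortedTail P ψ w) M y) :=
    fun w hw y hy => isLUB_levelQuantile (hanti w)
      (fun _ => distortedTail_eq_one P hψ1 hw) (fun _ => distortedTail_eq_zero P hψ0 hw) hy
  rw [hrepr _ hvuM, hrepr _ hvM, hrepr _ huM,
    ← integral_add (integrable_levelQuantile (hanti v).measurable M)
      (integrable_levelQuantile (hanti u).measurable M)]
  refine setIntegral_congr_fun measurableSet_Ioo fun y hy => ?_
  exact isLUB_add_of_comonotonic hcomo (U := fun A => y < ψ (P A).toReal)
    (fun A B hAB hA => hA.trans_le (distortion_measure_mono P hψmono hAB))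
    (hlub v hvM y hy) (hlub u huM y hy) (hlub _ hvuM y hy)
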